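/- Consider the joint state (orientation, gyro bias, velocity, accel bias, position, point P_f ∈ ℝ³, line (δθ_L ∈ ℝ³, δφ_L ∈ ℝ), plane Π ∈ ℝ³) of dimension 25. Under the hypotheses listed in the context (arbitrary bias blocks, H ∈ ℝ²ˣ³ with H(n_L − ⌊P_k×⌋v_L) = 0, ‖n‖ = 1, d ≠ 0), define the three block rows M_p = [Γ₁, Γ₂, −δtI₃, Γ₄, −I₃, I₃, 0₃ₓ₃, 0₃ₓ₁, 0₃ₓ₃], M_l = H·[Γ_{l1}, Γ_{l2}, δt⌊v_L×⌋, Γ_{l3}, ⌊v_L×⌋, 0₃ₓ₃, Γ_{l4}, Γ_{l5}, 0₃ₓ₃], and M_π = [Γ_{π1}, A, −δt·nnᵀ, B, −nnᵀ, 0₃ₓ₃, 0₃ₓ₃, 0₃ₓ₁, Γ_{π4}]. Let N_{plπ} ∈ ℝ²⁵ˣ⁴ have column 1 = (R₁ᵀg; 0; −⌊V₁×⌋g; 0; −⌊P₁×⌋g; −⌊P_f×⌋g; −g; 0; −⌊Π×⌋g) and columns 2–4 = (0; 0; 0; 0; I₃; I₃; (w₂/w₁)v_e·e₁ᵀR_Lᵀ;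 η²w₂²·e₃ᵀR_Lᵀ; n·e₃ᵀR_Πᵀ). Then M_p·N_{plπ} = 0, M_l·N_{plπ} = 0, and M_π·N_{plπ} = 0. Hence the linearized aided INS with one point, one line and one plane feature has at least 4 unobservable directions: rotation about gravity and global translation. -/

import Mathlib

open Matrix

noncomputable section

abbrev V3 : Type := Fin 3 → ℝ
abbrev M3 : Type := Matrix (Fin 3) (Fin 3) ℝ

/-- The skew-symmetric cross-product matrix `⌊v×⌋`. -/
def skew (v : V3) : M3 :=
  !![0, -(v 2), v 1; v 2, 0, -(v 0); -(v 1), v 0, 0]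

/-- `R` is a rotation matrix: `RᵀR = I₃` and `det R = 1`. -/
def IsRot (R : M3) : Prop := Rᵀ * R = 1 ∧ R.det = 1

/-- Euclidean norm on `ℝ³`. -/
def norm3 (v : V3) : ℝ := Real.sqrt (v ⬝ᵥ v)

def e1 : V3 := ![1, 0, 0]
def e2 : V3 := ![0, 1, 0]
def e3 : V3 := ![0, 0, 1]

/-- The 3×3 matrix with the given columns. -/
def cols3 (a b c : V3) : M3 := Matrix.of fun i j => ![a i, b i, c i] j

/-- The 3×3 matrix with the given rows. -/
def rows3 (a b c : V3) : M3 := Matrix.of ![a, b, c]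

/-- 25-dimensional joint point–line–plane state index
(orientation, gyro bias, velocity, accel bias, position, point, δθ_L, δφ_L, plane CP). -/
abbrev S25 : Type :=
  Fin 3 ⊕ Fin 3 ⊕ Fin 3 ⊕ Fin 3 ⊕ Fin 3 ⊕ Fin 3 ⊕ Fin 3 ⊕ Fin 1 ⊕ Fin 3

/-- The 3×25 block row `[A B C D E F G w Hm]`. -/
def rowPLP (A B C D E F G : M3) (w : V3) (Hm : M3) : Matrix (Fin 3) S25 ℝ :=
  Matrix.of fun i =>
    Sum.elim (fun j => A i j) (Sum.elim (fun j => B i j) (Sum.elim (fun j => C i j)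
      (Sum.elim (fun j => D i j) (Sum.elim (fun j => E i j)
        (Sum.elim (fun j => F i j) (Sum.elim (fun j => G i j)
          (Sum.elim (fun _ => w i) (fun j => Hm i j))))))))

/-- The stacked vector `(a; b; c; d; e; f; g'; s; h)` in ℝ²⁵. -/
def colPLP (a b c d e f g' : V3) (s : ℝ) (h : V3) : S25 → ℝ :=
  Sum.elim a (Sum.elim b (Sum.elim c (Sum.elim d (Sum.elim e
    (Sum.elim f (Sum.elim g' (Sum.elim (fun _ => s) h)))))))

/-- The 25×3 stacked blocks `(A; B; C; D; E; F; G; r; Hm)`. -/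
def stackPLP (A B C D E F G : M3) (r : V3) (Hm : M3) : Matrix S25 (Fin 3) ℝ :=
  Matrix.of (Sum.elim (fun i => A i) (Sum.elim (fun i => B i) (Sum.elim (fun i => C i)
    (Sum.elim (fun i => D i) (Sum.elim (fun i => E i)
      (Sum.elim (fun i => F i) (Sum.elim (fun i => G i)
        (Sum.elim (fun _ => r) (fun i => Hm i)))))))))

lemma rowPLP_mulVec_colPLP (A B C D E F G Hm : M3) (w a b c d e f g h : V3) (s : ℝ) :
    rowPLP A B C D E F G w Hm *ᵥ colPLP a b c d e f g s h =
      A *ᵥ a + B *ᵥ b + C *ᵥ c + D *ᵥ d + E *ᵥ e + F *ᵥ f + G *ᵥ g + s • w + Hm *ᵥ h := by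
  ext i
  simp [rowPLP, colPLP, mulVec, dotProduct, Fintype.sum_sum_type]
  ring

lemma rowPLP_mul_stackPLP (A B C D E F G Hm A' B' C' D' E' F' G' Hm' : M3) (w r : V3) :
    rowPLP A B C D E F G w Hm * stackPLP A' B' C' D' E' F' G' r Hm' =
      A * A' + B * B' + C * C' + D * D' + E * E' + F * F' + G * G' + vecMulVec w r
        + Hm * Hm' := by
  ext i j
  simp [rowPLP, stackPLP, mul_apply, vecMulVec_apply, Fintype.sum_sum_type]
  ring

lemma mul_of_sumElim_eq_zero {m n k : Type*} [Fintype n] (M : Matrix m n ℝ) (c : n → ℝ)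
    (C : Matrix n k ℝ) (hc : M *ᵥ c = 0) (hC : M * C = 0) :
    M * (Matrix.of fun s => Sum.elim (fun _ : Fin 1 => c s) (fun j : k => C s j)) = 0 := by
  ext i j
  rcases j with j | j
  · exact congrFun hc i
  · exact congrFun (congrFun hC i) j

lemma skew_mulVec (a b : V3) : skew a *ᵥ b = crossProduct a b := by
  ext i
  fin_cases i <;> simp [skew, mulVec, dotProduct, Fin.sum_univ_three, cross_apply] <;> ring

lemma skew_add (a b : V3) : skew (a + b) = skew a + skew b := by
  ext i j
  fin_cases i <;> fin_cases j <;> simp [skew] <;> ring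

lemma skew_sub (a b : V3) : skew (a - b) = skew a - skew b := by
  ext i j
  fin_cases i <;> fin_cases j <;> simp [skew] <;> ring

lemma skew_smul (t : ℝ) (a : V3) : skew (t • a) = t • skew a := by
  ext i j
  fin_cases i <;> fin_cases j <;> simp [skew]

lemma skew_skew_mulVec (a b : V3) :
    skew (skew a *ᵥ b) = vecMulVec b a - vecMulVec a b := by
  ext i j
  fin_cases i <;> fin_cases j <;>
    simp [skew, vecMulVec_apply, mulVec, dotProduct, Fin.sum_univ_three] <;> ring

lemma skew_skew_mulVec_self (a b : V3) :
    skew (skew a *ᵥ b) *ᵥ a = (a ⬝ᵥ a) • b - (a ⬝ᵥ b) • a := by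
  rw [skew_skew_mulVec, sub_mulVec, vecMulVec_mulVec, vecMulVec_mulVec, dotProduct_comm b a]
  simp

lemma vecMulVec_mul_transpose (a b : V3) (R : M3) :
    vecMulVec a b * Rᵀ = vecMulVec a (R *ᵥ b) := by
  rw [vecMulVec_mul, vecMul_transpose]

lemma cols3_mulVec_e1 (a b c : V3) : cols3 a b c *ᵥ e1 = a := by
  ext i
  simp [cols3, e1, mulVec, dotProduct, Fin.sum_univ_three]

lemma cols3_mulVec_e3 (a b c : V3) : cols3 a b c *ᵥ e3 = c := by
  ext i
  simp [cols3, e3, mulVec, dotProduct, Fin.sum_univ_three]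

lemma norm3_sq (v : V3) : norm3 v ^ 2 = v ⬝ᵥ v :=
  Real.sq_sqrt (by simpa using dotProduct_star_self_nonneg v)

lemma norm3_ne_zero {v : V3} (hv : v ≠ 0) : norm3 v ≠ 0 := by
  intro h
  have := norm3_sq v
  rw [h] at this
  exact hv (dotProduct_self_eq_zero.mp (by simpa using this.symm))

/-- For orthogonal `a`, `b`, the matrix `skew b` lies in the span of the dyads of `a` and
`a × b`. -/
lemma dotProduct_self_smul_skew {a b : V3} (h : a ⬝ᵥ b = 0) :
    (a ⬝ᵥ a) • skew b = vecMulVec a (skew a *ᵥ b) - vecMulVec (skew a *ᵥ b) a := by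
  rw [← skew_skew_mulVec, skew_skew_mulVec_self, h, zero_smul, sub_zero, skew_smul]

lemma IsRot.mul_mulVec_transpose {R : M3} (hR : IsRot R) (K : M3) (g : V3) :
    (K * R) *ᵥ (Rᵀ *ᵥ g) = K *ᵥ g := by
  rw [mulVec_mulVec, Matrix.mul_assoc, mul_eq_one_comm.mp hR.1, Matrix.mul_one]

/-- the linearized aided INS with one point, one line and one plane
feature has at least 4 unobservable directions. -/
theorem point_line_plane_unobservable_directions
    (nL vL n np1 np2 g Pf P₁ V₁ Pk : V3) (d δt : ℝ) (R₁ : M3) (hR₁ : IsRot R₁)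
    (hnL : nL ≠ 0) (hvL : vL ≠ 0) (horth : nL ⬝ᵥ vL = 0)
    (hn : norm3 n = 1) (hd : d ≠ 0)
    (h11 : np1 ⬝ᵥ np1 = 1) (h22 : np2 ⬝ᵥ np2 = 1) (h12 : np1 ⬝ᵥ np2 = 0)
    (h1n : np1 ⬝ᵥ n = 0) (h2n : np2 ⬝ᵥ n = 0)
    (Γ₂ Γ₄ Γl2 Γl3 A B : M3) (H : Matrix (Fin 2) (Fin 3) ℝ)
    (hH : H *ᵥ (nL - skew Pk *ᵥ vL) = 0) :
    let w₁ : ℝ := norm3 nL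
    let w₂ : ℝ := norm3 vL
    let nE : V3 := w₁⁻¹ • nL
    let vE : V3 := w₂⁻¹ • vL
    let ηsq : ℝ := (w₁ ^ 2 + w₂ ^ 2)⁻¹
    let RL : M3 := cols3 nE vE (skew nE *ᵥ vE)
    let RPi : M3 := cols3 np1 np2 n
    let cp : V3 := d • n
    let Γ₁ : M3 := skew (Pf - P₁ - δt • V₁ + (δt ^ 2 / 2) • g) * R₁
    let Γl1 : M3 := (skew nL - skew (skew Pk *ᵥ vL) + skew vL * skew P₁
        + δt • (skew vL * skew V₁) - (δt ^ 2 / 2) • (skew vL * skew g)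
        - skew vL * skew Pk) * R₁
    let Γl4 : M3 := skew nL - skew Pk * skew vL
    let Γl5 : V3 := -((w₂ / w₁) • nL + (w₁ / w₂) • (skew Pk *ᵥ vL))
    let Γπ1 : M3 := ((d - n ⬝ᵥ Pk) • skew n
        - vecMulVec n n * skew (P₁ + δt • V₁ - (δt ^ 2 / 2) • g - Pk)) * R₁
    let Γπ4 : M3 := d⁻¹ • ((d - n ⬝ᵥ Pk) • (1 : M3) - vecMulVec n Pk
        + (2 * (n ⬝ᵥ Pk)) • vecMulVec n n)
    let Mp : Matrix (Fin 3) S25 ℝ :=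
      rowPLP Γ₁ Γ₂ ((-δt) • (1 : M3)) Γ₄ (-1) 1 0 0 0
    let Ml : Matrix (Fin 2) S25 ℝ :=
      H * rowPLP Γl1 Γl2 (δt • skew vL) Γl3 (skew vL) 0 Γl4 Γl5 0
    let Mπ : Matrix (Fin 3) S25 ℝ :=
      rowPLP Γπ1 A ((-δt) • vecMulVec n n) B (-(vecMulVec n n)) 0 0 0 Γπ4
    let c1 : S25 → ℝ :=
      colPLP (R₁ᵀ *ᵥ g) 0 (-(skew V₁ *ᵥ g)) 0 (-(skew P₁ *ᵥ g))
        (-(skew Pf *ᵥ g)) (-g) 0 (-(skew cp *ᵥ g))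
    let Cm : Matrix S25 (Fin 3) ℝ :=
      stackPLP 0 0 0 0 1 1 (((w₂ / w₁) • vecMulVec vE e1) * RLᵀ)
        ((ηsq * w₂ ^ 2) • (e3 ᵥ* RLᵀ)) (vecMulVec n e3 * RPiᵀ)
    let Nplπ : Matrix S25 (Fin 1 ⊕ Fin 3) ℝ :=
      Matrix.of fun s => Sum.elim (fun _ : Fin 1 => c1 s) (fun j : Fin 3 => Cm s j)
    Mp * Nplπ = 0 ∧ Ml * Nplπ = 0 ∧ Mπ * Nplπ = 0 := by
  intro w₁ w₂ nE vE ηsq RL RPi cp Γ₁ Γl1 Γl4 Γl5 Γπ1 Γπ4 Mp Ml Mπ c1 Cm Nplπ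
  have hw₁ : w₁ ≠ 0 := norm3_ne_zero hnL
  have hw₂ : w₂ ≠ 0 := norm3_ne_zero hvL
  have hη : w₁ ^ 2 + w₂ ^ 2 ≠ 0 := by positivity
  have hnn : n ⬝ᵥ n = 1 := by rw [← norm3_sq, hn, one_pow]
  have hCm : Cm = stackPLP 0 0 0 0 1 1 ((w₂ / w₁) • vecMulVec vE nE)
      ((ηsq * w₂ ^ 2) • (skew nE *ᵥ vE)) (vecMulVec n n) := by
    simp only [Cm, RL, RPi, smul_mul, vecMulVec_mul_transpose, vecMul_transpose, cols3_mulVec_e1,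
      cols3_mulVec_e3]
  refine ⟨mul_of_sumElim_eq_zero _ _ _ ?_ ?_, mul_of_sumElim_eq_zero _ _ _ ?_ ?_,
    mul_of_sumElim_eq_zero _ _ _ ?_ ?_⟩
  · simp only [Mp, c1, Γ₁, rowPLP_mulVec_colPLP, hR₁.mul_mulVec_transpose]
    simp only [skew_add, skew_sub, skew_smul, add_mulVec, sub_mulVec, smul_mulVec, neg_mulVec,
      one_mulVec, skew_mulVec, cross_self]
    simp [-cross_anticomm]
  · rw [hCm, rowPLP_mul_stackPLP]
    simp
  · simp only [Ml, c1, ← mulVec_mulVec, rowPLP_mulVec_colPLP, Γl1, Γl4, hR₁.mul_mulVec_transpose]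
    refine (congrArg (H *ᵥ ·) ?_).trans (mulVec_zero H)
    simp only [add_mulVec, sub_mulVec, smul_mulVec, ← mulVec_mulVec, skew_mulVec, cross_self,
      cross_cross, mulVec_neg]
    simp [-cross_anticomm]
    module
  · rw [hCm]
    simp only [Ml]
    rw [Matrix.mul_assoc, rowPLP_mul_stackPLP]
    set p : V3 := skew nL *ᵥ vL with hp
    have hskew : skew vL = (w₁ ^ 2)⁻¹ • (vecMulVec nL p - vecMulVec p nL) := by
      rw [← dotProduct_self_smul_skew horth, ← norm3_sq, smul_smul,
        inv_mul_cancel₀ (pow_ne_zero 2 hw₁), one_smul]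
    have h4 : Γl4 *ᵥ vL = p := by
      simp only [Γl4, sub_mulVec, ← mulVec_mulVec, hp]
      simp [skew_mulVec vL vL]
    have hl : skew nE *ᵥ vE = (w₁⁻¹ * w₂⁻¹) • p := by
      simp only [nE, vE, skew_smul, smul_mulVec, mulVec_smul, smul_smul, hp, mul_comm]
    have h4' : Γl4 * ((w₂ / w₁) • vecMulVec vE nE) = (w₁ ^ 2)⁻¹ • vecMulVec p nL := by
      simp only [nE, vE, smul_vecMulVec, vecMulVec_smul, Matrix.mul_smul, mul_vecMulVec, h4,
        smul_smul]
      congr 1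
      field_simp
    have hΓl5 : H *ᵥ Γl5 = -((w₂ / w₁ + w₁ / w₂) • (H *ᵥ nL)) := by
      rw [mulVec_sub, sub_eq_zero] at hH
      simp only [Γl5, mulVec_neg, mulVec_add, mulVec_smul, ← hH, add_smul]
    rw [hl, h4', hskew]
    simp only [Matrix.mul_zero, zero_mulVec, zero_vecMulVec, Matrix.mul_one, zero_add, add_zero,
      Matrix.mul_add, Matrix.mul_sub, Matrix.mul_smul, mul_vecMulVec, hΓl5, smul_smul,
      vecMulVec_smul, neg_vecMulVec, smul_vecMulVec, smul_sub, smul_neg]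
    have hc : ηsq * w₂ ^ 2 * (w₁⁻¹ * w₂⁻¹) * (w₂ / w₁ + w₁ / w₂) = (w₁ ^ 2)⁻¹ := by
      simp only [ηsq]
      field_simp
      ring
    rw [hc]
    abel
  · simp only [Mπ, c1, Γπ1, rowPLP_mulVec_colPLP, hR₁.mul_mulVec_transpose]
    have htriple : Pk ⬝ᵥ crossProduct n g = -(n ⬝ᵥ crossProduct Pk g) := by
      rw [triple_product_permutation, ← cross_anticomm, dotProduct_neg]
    simp only [Γπ4, cp, skew_add, skew_sub, skew_smul, add_mulVec, sub_mulVec, smul_mulVec,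
      neg_mulVec, ← mulVec_mulVec, mulVec_neg, mulVec_add, mulVec_sub, mulVec_smul, skew_mulVec,
      vecMulVec_mulVec, cross_self, htriple, dot_self_cross, one_mulVec]
    simp [smul_smul, hd]
    module
  · have h4 : Γπ4 *ᵥ n = n := by
      simp only [Γπ4, add_mulVec, sub_mulVec, smul_mulVec, vecMulVec_mulVec, one_mulVec, hnn,
        dotProduct_comm Pk n]
      ext i
      simp
      field_simp
      ring
    rw [hCm, rowPLP_mul_stackPLP, mul_vecMulVec, h4]
    simp
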